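/- For any y ∈ ℝ^M in the range of H, the solution set β = argmin { ‖a‖₁ : a ∈ ℝ^N, H a = y } of the constrained minimum-ℓ₁ problem is nonempty, convex, and compact, and every extreme point of β has at most M nonzero entries. -/

import Mathlib

open Filter Topology in
/-- A small multiple of `v` is dominated entrywise by `a` when `v` vanishes wherever `a` does. -/
theorem exists_pos_forall_mul_abs_le {ι : Type*} [Finite ι] {a v : ι → ℝ}
    (h : ∀ n, a n = 0 → v n = 0) : ∃ t : ℝ, 0 < t ∧ ∀ n, t * |v n| ≤ |a n| := by
  have key : ∀ᶠ t : ℝ in 𝓝[>] 0, ∀ n, t * |v n| ≤ |a n| := by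
    refine eventually_all.2 fun n => ?_
    by_cases ha : a n = 0
    · simp [ha, h n ha]
    · have hc : Tendsto (fun t : ℝ => t * |v n|) (𝓝 0) (𝓝 (0 * |v n|)) :=
        tendsto_id.mul_const _
      rw [zero_mul] at hc
      exact ((hc.mono_left nhdsWithin_le_nhds).eventually_lt_const (abs_pos.2 ha)).mono
        fun t ht => ht.le
  obtain ⟨t, ht, ht0⟩ := (key.and self_mem_nhdsWithin).exists
  exact ⟨t, ht0, ht⟩

theorem abs_add_add_abs_sub_of_abs_le {x z : ℝ} (h : |z| ≤ |x|) :
    |x + z| + |x - z| = 2 * |x| := by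
  grind

/-- If `a` has more nonzero entries than `H` has rows, then the kernel of `H` contains a nonzero
vector supported on the support of `a`. -/
theorem Matrix.exists_ne_zero_mulVec_eq_zero_of_card_lt {m n : Type*} [Fintype m] [Fintype n]
    (H : Matrix m n ℝ) (a : n → ℝ)
    (h : Fintype.card m < (Finset.univ.filter fun i => a i ≠ 0).card) :
    ∃ v : n → ℝ, v ≠ 0 ∧ H.mulVec v = 0 ∧ ∀ i, a i = 0 → v i = 0 := by
  let L : (n → ℝ) →ₗ[ℝ] (m → ℝ) × ({i // a i = 0} → ℝ) :=
    H.mulVecLin.prod (LinearMap.funLeft ℝ ℝ Subtype.val)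
  have hcard := Finset.card_filter_add_card_filter_not (s := Finset.univ) fun i : n => a i = 0
  have hL : LinearMap.ker L ≠ ⊥ := by
    apply LinearMap.ker_ne_bot_of_finrank_lt
    rw [Module.finrank_prod, Module.finrank_fintype_fun_eq_card,
      Module.finrank_fintype_fun_eq_card, Module.finrank_fintype_fun_eq_card,
      Fintype.card_subtype]
    rw [Finset.card_univ] at hcard
    simp only [ne_eq] at h
    omega
  obtain ⟨v, hv, hv0⟩ := (Submodule.ne_bot_iff _).1 hL
  obtain ⟨h₁, h₂⟩ := Prod.ext_iff.1 (LinearMap.mem_ker.1 hv)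
  exact ⟨v, hv0, h₁, fun i hi => congrFun h₂ ⟨i, hi⟩⟩

theorem convex_setOf_sum_abs_le {ι : Type*} [Fintype ι] (c : ℝ) :
    Convex ℝ {a : ι → ℝ | ∑ n, |a n| ≤ c} := by
  intro a ha b hb s t hs ht hst
  calc ∑ n, |(s • a + t • b) n| ≤ ∑ n, (s * |a n| + t * |b n|) := by
        refine Finset.sum_le_sum fun n _ => (abs_add_le _ _).trans_eq ?_
        simp [abs_mul, abs_of_nonneg hs, abs_of_nonneg ht]
    _ = s * ∑ n, |a n| + t * ∑ n, |b n| := by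
        rw [Finset.sum_add_distrib, Finset.mul_sum, Finset.mul_sum]
    _ ≤ s * c + t * c :=
        add_le_add (mul_le_mul_of_nonneg_left ha hs) (mul_le_mul_of_nonneg_left hb ht)
    _ = c := by rw [← add_mul, hst, one_mul]

theorem isCompact_setOf_sum_abs_le {ι : Type*} [Fintype ι] (c : ℝ) :
    IsCompact {a : ι → ℝ | ∑ n, |a n| ≤ c} := by
  refine Metric.isCompact_of_isClosed_isBounded
    (isClosed_le (by fun_prop) continuous_const)
    ((Metric.isBounded_closedBall (x := 0) (r := c)).subset fun a ha => ?_)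
  rw [mem_closedBall_zero_iff]
  refine (pi_norm_le_iff_of_nonneg ((Finset.sum_nonneg fun n _ => abs_nonneg _).trans ha)).2
    fun n => ?_
  exact (Finset.single_le_sum (f := fun n => |a n|) (fun n _ => abs_nonneg _)
    (Finset.mem_univ n)).trans ha


/-- For any `y` in the range of `H`, the solution set of the constrained minimum-ℓ₁
problem `min { ‖a‖₁ : H a = y }` is nonempty, convex, and compact, and every extreme
point of it has at most `M` nonzero entries. -/
theorem min_l1_solution_set_properties
    {M N : ℕ} (hMN : M < N) (H : Matrix (Fin M) (Fin N) ℝ) (y : Fin M → ℝ)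
    (hy : ∃ a₀ : Fin N → ℝ, H.mulVec a₀ = y)
    (β : Set (Fin N → ℝ))
    (hβ : β = {a : Fin N → ℝ | H.mulVec a = y ∧
      ∀ b : Fin N → ℝ, H.mulVec b = y → (∑ n : Fin N, |a n|) ≤ ∑ n : Fin N, |b n|}) :
    β.Nonempty ∧ Convex ℝ β ∧ IsCompact β ∧
      ∀ a ∈ Set.extremePoints ℝ β,
        (Finset.univ.filter fun n : Fin N => a n ≠ 0).card ≤ M := by
  obtain ⟨a₀, ha₀⟩ := hy
  have hclosed : IsClosed {a : Fin N → ℝ | H.mulVec a = y} :=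
    isClosed_eq (by fun_prop) continuous_const
  obtain ⟨p, ⟨hp, hpc⟩, hmin⟩ :=
    ((isCompact_setOf_sum_abs_le (∑ n, |a₀ n|)).inter_left hclosed).exists_isMinOn
      ⟨a₀, ha₀, le_refl (∑ n, |a₀ n|)⟩
      (f := fun a : Fin N → ℝ => ∑ n, |a n|) (by fun_prop)
  have hpmin : ∀ b : Fin N → ℝ, H.mulVec b = y → ∑ n, |p n| ≤ ∑ n, |b n| := by
    intro b hb
    rcases le_total (∑ n, |b n|) (∑ n, |a₀ n|) with h | h
    · exact hmin ⟨hb, h⟩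
    · exact le_trans hpc h
  have hβ' : β = {a | H.mulVec a = y} ∩ {a | ∑ n, |a n| ≤ ∑ n, |p n|} := by
    rw [hβ]
    ext a
    exact ⟨fun h => ⟨h.1, h.2 p hp⟩, fun h => ⟨h.1, fun b hb => le_trans h.2 (hpmin b hb)⟩⟩
  refine ⟨⟨p, hβ' ▸ ⟨hp, le_refl (∑ n, |p n|)⟩⟩, ?_, ?_, ?_⟩
  · rw [hβ']
    exact ((convex_singleton y).linear_preimage H.mulVecLin).inter (convex_setOf_sum_abs_le _)
  · rw [hβ']
    exact (isCompact_setOf_sum_abs_le _).inter_left hclosed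
  · intro a ha
    by_contra! hlt
    obtain ⟨v, hv0, hHv, hsupp⟩ :=
      H.exists_ne_zero_mulVec_eq_zero_of_card_lt a (by rwa [Fintype.card_fin])
    obtain ⟨t, ht, hle⟩ := exists_pos_forall_mul_abs_le hsupp
    have haβ := ha.1
    rw [hβ'] at haβ
    obtain ⟨haH : H.mulVec a = y, hap : ∑ n, |a n| ≤ ∑ n, |p n|⟩ := haβ
    have hadd : H.mulVec (a + t • v) = y := by
      rw [Matrix.mulVec_add, Matrix.mulVec_smul, hHv, smul_zero, add_zero, haH]
    have hsub : H.mulVec (a - t • v) = y := by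
      rw [Matrix.mulVec_sub, Matrix.mulVec_smul, hHv, smul_zero, sub_zero, haH]
    have hsum : ∑ n, |(a + t • v) n| + ∑ n, |(a - t • v) n| = 2 * ∑ n, |a n| := by
      rw [← Finset.sum_add_distrib, Finset.mul_sum]
      refine Finset.sum_congr rfl fun n _ => abs_add_add_abs_sub_of_abs_le ?_
      simpa [abs_mul, abs_of_pos ht] using hle n
    have haddmin := hpmin _ hadd
    have hsubmin := hpmin _ hsub
    have haddβ : a + t • v ∈ β := hβ' ▸ ⟨hadd, by rw [Set.mem_ofPred_eq]; linarith⟩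
    have hsubβ : a - t • v ∈ β := hβ' ▸ ⟨hsub, by rw [Set.mem_ofPred_eq]; linarith⟩
    have hmem : a ∈ openSegment ℝ (a + t • v) (a - t • v) :=
      ⟨1 / 2, 1 / 2, by norm_num, by norm_num, by norm_num, by module⟩
    have heq : a + t • v = a := ha.2 haddβ hsubβ hmem
    exact (smul_ne_zero ht.ne' hv0) (add_eq_left.1 heq)
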